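/- Let F : ℝ³ → ℝ³ be a smooth (C^∞) vector field with compact support. Define F_c(r) = (1/(4π)) ∫_{ℝ³} (div F)(r') · (r − r')/‖r − r'‖³ dr' and F_s(r) = (1/(4π)) ∫_{ℝ³} (curl F)(r') × (r − r')/‖r − r'‖³ dr'. Then F = F_c + F_s everywhere on ℝ³, the field F_c is irrotational (curl F_c = 0 everywhere), and the field F_s is divergence-free (div F_s = 0 everywhere). -/

import Mathlib

open MeasureTheory Real

noncomputable section

/-- ℝ³ with the Euclidean norm. -/
abbrev E3 : Type := EuclideanSpace ℝ (Fin 3)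

/-- The `i`-th partial derivative of a scalar field on ℝ³. -/
def pd (i : Fin 3) (f : E3 → ℝ) (x : E3) : ℝ :=
  fderiv ℝ f x (EuclideanSpace.single i 1)

/-- Divergence of a vector field on ℝ³: div A = ∂₁A₁ + ∂₂A₂ + ∂₃A₃. -/
def div3 (F : E3 → E3) (x : E3) : ℝ :=
  pd 0 (fun y => F y 0) x + pd 1 (fun y => F y 1) x + pd 2 (fun y => F y 2) x

/-- Curl of a vector field on ℝ³:
curl A = (∂₂A₃ − ∂₃A₂, ∂₃A₁ − ∂₁A₃, ∂₁A₂ − ∂₂A₁). -/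
def curl3 (F : E3 → E3) (x : E3) : E3 :=
  (WithLp.equiv 2 (Fin 3 → ℝ)).symm
    ![pd 1 (fun y => F y 2) x - pd 2 (fun y => F y 1) x,
      pd 2 (fun y => F y 0) x - pd 0 (fun y => F y 2) x,
      pd 0 (fun y => F y 1) x - pd 1 (fun y => F y 0) x]

/-- Gradient of a scalar field on ℝ³: ∇Φ = (∂₁Φ, ∂₂Φ, ∂₃Φ). -/
def grad3 (f : E3 → ℝ) (x : E3) : E3 :=
  (WithLp.equiv 2 (Fin 3 → ℝ)).symm ![pd 0 f x, pd 1 f x, pd 2 f x]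

/-- Laplacian of a scalar field on ℝ³: ΔΦ = ∂₁²Φ + ∂₂²Φ + ∂₃²Φ. -/
def lap3 (f : E3 → ℝ) (x : E3) : ℝ :=
  pd 0 (pd 0 f) x + pd 1 (pd 1 f) x + pd 2 (pd 2 f) x

/-- Cross product on ℝ³. -/
def cross3 (a b : E3) : E3 :=
  (WithLp.equiv 2 (Fin 3 → ℝ)).symm
    ![a 1 * b 2 - a 2 * b 1, a 2 * b 0 - a 0 * b 2, a 0 * b 1 - a 1 * b 0]

/-- Conservative part of the Helmholtz decomposition:
F_c(r) = (1/(4π)) ∫ (div F)(r') · (r − r')/‖r − r'‖³ dr'. -/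
def helmholtzConservative (F : E3 → E3) (r : E3) : E3 :=
  (1 / (4 * Real.pi)) • ∫ r' : E3, (‖r - r'‖ ^ 3)⁻¹ • ((div3 F r') • (r - r'))

/-- Solenoidal part of the Helmholtz decomposition:
F_s(r) = (1/(4π)) ∫ (curl F)(r') × (r − r')/‖r − r'‖³ dr'. -/
def helmholtzSolenoidal (F : E3 → E3) (r : E3) : E3 :=
  (1 / (4 * Real.pi)) • ∫ r' : E3, (‖r - r'‖ ^ 3)⁻¹ • cross3 (curl3 F r') (r - r')

open Set Filter Topology

/-- The `i`-th component of the regularized kernel `x / (s + ‖x‖²)^(3/2)`; at `s = 0` this is the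
`i`-th component of `x / ‖x‖³`. -/
def regKernel (s : ℝ) (i : Fin 3) (x : E3) : ℝ :=
  x i * (s + ‖x‖ ^ 2) ^ (-(3 / 2) : ℝ)

lemma norm_sq_rpow_neg_three_halves (x : E3) : (‖x‖ ^ 2) ^ (-(3 / 2) : ℝ) = (‖x‖ ^ 3)⁻¹ := by
  rw [← Real.rpow_natCast_mul (norm_nonneg x), ← Real.rpow_natCast, ← Real.rpow_neg (norm_nonneg x)]
  norm_num

lemma regKernel_zero (i : Fin 3) (x : E3) : regKernel 0 i x = (‖x‖ ^ 3)⁻¹ * x i := by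
  rw [regKernel, zero_add, norm_sq_rpow_neg_three_halves, mul_comm]

lemma norm_regKernel_zero_le (i : Fin 3) (x : E3) : ‖regKernel 0 i x‖ ≤ ‖x‖ ^ (-2 : ℝ) := by
  rcases eq_or_ne x 0 with rfl | hx
  · simp [regKernel]
  · have h : 0 < ‖x‖ := norm_pos_iff.mpr hx
    rw [regKernel_zero, norm_mul, norm_inv, norm_pow, norm_norm, Real.rpow_neg h.le]
    have := PiLp.norm_apply_le x i
    calc (‖x‖ ^ 3)⁻¹ * ‖x i‖ ≤ (‖x‖ ^ 3)⁻¹ * ‖x‖ := by gcongr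
      _ = (‖x‖ ^ (2 : ℝ))⁻¹ := by
        norm_cast
        field_simp

lemma norm_regKernel_le {s : ℝ} (hs : 0 ≤ s) (i : Fin 3) (x : E3) :
    ‖regKernel s i x‖ ≤ ‖regKernel 0 i x‖ := by
  rcases eq_or_ne x 0 with rfl | hx
  · simp [regKernel]
  · have h : 0 < ‖x‖ := norm_pos_iff.mpr hx
    simp only [regKernel, norm_mul]
    gcongr ?_ * ?_
    rw [Real.norm_of_nonneg (by positivity), Real.norm_of_nonneg (by positivity)]
    exact Real.rpow_le_rpow_of_nonpos (by positivity) (by linarith) (by norm_num)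

lemma measurable_regKernel (s : ℝ) (i : Fin 3) : Measurable (regKernel s i) := by
  unfold regKernel
  fun_prop

lemma locallyIntegrable_regKernel_zero (i : Fin 3) : LocallyIntegrable (regKernel 0 i) := by
  refine locallyIntegrable_of_norm_le_rpow (C := 1) (α := 2) (by simp) (by simp; norm_num)
    (ae_of_all _ fun x => ?_) (measurable_regKernel 0 i).aestronglyMeasurable
  simpa using norm_regKernel_zero_le i x

lemma locallyIntegrable_regKernel {s : ℝ} (hs : 0 ≤ s) (i : Fin 3) :
    LocallyIntegrable (regKernel s i) :=
  (locallyIntegrable_regKernel_zero i).mono (measurable_regKernel s i).aestronglyMeasurable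
    (ae_of_all _ fun x => norm_regKernel_le hs i x)

lemma integrable_regKernel_mul {s : ℝ} (hs : 0 ≤ s) (i : Fin 3) {v : E3 → ℝ} (hv : Continuous v)
    (hc : HasCompactSupport v) : Integrable fun x => regKernel s i x * v x :=
  (locallyIntegrable_regKernel hs i).integrable_smul_right_of_hasCompactSupport hv hc

lemma tendsto_regKernel (i : Fin 3) (x : E3) :
    Tendsto (fun s => regKernel s i x) (𝓝[>] 0) (𝓝 (regKernel 0 i x)) := by
  rcases eq_or_ne x 0 with rfl | hx
  · simp [regKernel]
  · have h : 0 < ‖x‖ := norm_pos_iff.mpr hx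
    refine Tendsto.mono_left (ContinuousAt.tendsto ?_) nhdsWithin_le_nhds
    unfold regKernel
    refine continuousAt_const.mul (ContinuousAt.rpow_const (by fun_prop) (Or.inl ?_))
    positivity

lemma tendsto_integral_regKernel_mul (i : Fin 3) {v : E3 → ℝ} (hv : Continuous v)
    (hc : HasCompactSupport v) :
    Tendsto (fun s => ∫ x, regKernel s i x * v x) (𝓝[>] 0) (𝓝 (∫ x, regKernel 0 i x * v x)) := by
  refine tendsto_integral_filter_of_dominated_convergence (fun x => ‖regKernel 0 i x * v x‖)
    ?_ ?_ (integrable_regKernel_mul le_rfl i hv hc).norm ?_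
  · exact Eventually.of_forall fun s =>
      ((measurable_regKernel s i).mul hv.measurable).aestronglyMeasurable
  · filter_upwards [self_mem_nhdsWithin] with s hs
    refine ae_of_all _ fun x => ?_
    rw [norm_mul, norm_mul]
    gcongr
    exact norm_regKernel_le (le_of_lt hs) i x
  · exact ae_of_all _ fun x => (tendsto_regKernel i x).mul_const _

lemma contDiff_regKernel {s : ℝ} (hs : 0 < s) (i : Fin 3) : ContDiff ℝ 1 (regKernel s i) := by
  unfold regKernel
  refine ContDiff.mul (by fun_prop) (ContDiff.rpow_const_of_ne ?_ fun x => by positivity)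
  exact contDiff_const.add (contDiff_norm_sq ℝ)

lemma pd_regKernel {s : ℝ} (hs : 0 < s) (i j : Fin 3) (x : E3) :
    pd j (regKernel s i) x = (if i = j then 1 else 0) * (s + ‖x‖ ^ 2) ^ (-(3 / 2) : ℝ)
      - 3 * x i * x j * (s + ‖x‖ ^ 2) ^ (-(5 / 2) : ℝ) := by
  have h1 : HasFDerivAt (fun y : E3 => s + ‖y‖ ^ 2) (2 • innerSL ℝ x) x :=
    (hasStrictFDerivAt_norm_sq x).hasFDerivAt.const_add s
  have h2 := h1.rpow_const (p := (-(3 / 2) : ℝ)) (Or.inl (by positivity))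
  have h3 : HasFDerivAt (fun y : E3 => y i) (EuclideanSpace.proj i : E3 →L[ℝ] ℝ) x :=
    (EuclideanSpace.proj i : E3 →L[ℝ] ℝ).hasFDerivAt
  have h4 : fderiv ℝ (regKernel s i) x = _ := (h3.mul h2).fderiv
  rw [pd, h4]
  have : (-(3 / 2) - 1 : ℝ) = -(5 / 2) := by norm_num
  simp [EuclideanSpace.inner_single_right, this]
  split_ifs <;> ring

lemma pd_regKernel_comm {s : ℝ} (hs : 0 < s) (i j : Fin 3) :
    pd j (regKernel s i) = pd i (regKernel s j) := by
  ext x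
  simp only [pd_regKernel hs, eq_comm (a := i)]
  ring

lemma sum_pd_regKernel {s : ℝ} (hs : 0 < s) (x : E3) :
    ∑ i, pd i (regKernel s i) x = 3 * s * (s + ‖x‖ ^ 2) ^ (-(5 / 2) : ℝ) := by
  have h : (s + ‖x‖ ^ 2) ^ (-(3 / 2) : ℝ) = (s + ‖x‖ ^ 2) * (s + ‖x‖ ^ 2) ^ (-(5 / 2) : ℝ) := by
    rw [← Real.rpow_one_add' (by positivity) (by norm_num)]
    norm_num
  have hn : x 0 ^ 2 + x 1 ^ 2 + x 2 ^ 2 = ‖x‖ ^ 2 := by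
    rw [EuclideanSpace.real_norm_sq_eq, Fin.sum_univ_three]
  simp only [pd_regKernel hs, h, Fin.sum_univ_three, if_true]
  linear_combination -3 * (s + ‖x‖ ^ 2) ^ (-(5 / 2) : ℝ) * hn

lemma ContDiff.continuous_pd {f : E3 → ℝ} (hf : ContDiff ℝ 1 f) (i : Fin 3) :
    Continuous (pd i f) :=
  (hf.continuous_fderiv one_ne_zero).clm_apply continuous_const

lemma ContDiff.pd {f : E3 → ℝ} (hf : ContDiff ℝ (⊤ : ℕ∞) f) (i : Fin 3) :
    ContDiff ℝ (⊤ : ℕ∞) (pd i f) :=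
  (hf.fderiv_right (by simp)).clm_apply contDiff_const

lemma HasCompactSupport.pd {f : E3 → ℝ} (hf : HasCompactSupport f) (i : Fin 3) :
    HasCompactSupport (pd i f) :=
  hf.fderiv_apply ℝ _

lemma integral_regKernel_mul_pd {s : ℝ} (hs : 0 < s) (i j : Fin 3) {v : E3 → ℝ}
    (hv : ContDiff ℝ 1 v) (hc : HasCompactSupport v) :
    ∫ x, regKernel s i x * pd j v x = -∫ x, pd j (regKernel s i) x * v x := by
  have hk := contDiff_regKernel hs i
  refine integral_mul_fderiv_eq_neg_fderiv_mul_of_integrable ?_ ?_ ?_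
    (fun x _ => hk.differentiable one_ne_zero x) (fun x _ => hv.differentiable one_ne_zero x)
  · exact ((hk.continuous_pd j).mul hv.continuous).integrable_of_hasCompactSupport hc.mul_left
  · exact integrable_regKernel_mul hs.le i (hv.continuous_pd j) (hc.pd j)
  · exact integrable_regKernel_mul hs.le i hv.continuous hc

lemma integral_regKernel_zero_mul_pd_comm (i j : Fin 3) {v : E3 → ℝ}
    (hv : ContDiff ℝ 1 v) (hc : HasCompactSupport v) :
    ∫ x, regKernel 0 i x * pd j v x = ∫ x, regKernel 0 j x * pd i v x := by
  refine tendsto_nhds_unique_of_eventuallyEq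
    (tendsto_integral_regKernel_mul i (hv.continuous_pd j) (hc.pd j))
    (tendsto_integral_regKernel_mul j (hv.continuous_pd i) (hc.pd i)) ?_
  filter_upwards [self_mem_nhdsWithin] with s hs
  rw [integral_regKernel_mul_pd hs i j hv hc, integral_regKernel_mul_pd hs j i hv hc,
    pd_regKernel_comm hs]

lemma integral_Ioi_sq_mul_one_add_sq_rpow :
    ∫ y in Ioi (0 : ℝ), y ^ 2 * (3 * (1 + y ^ 2) ^ (-(5 / 2) : ℝ)) = 1 := by
  have hlim : Tendsto (fun y : ℝ => y ^ 3 * (1 + y ^ 2) ^ (-(3 / 2) : ℝ)) atTop (𝓝 1) := by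
    have h1 : Tendsto (fun y : ℝ => ((y ^ 2)⁻¹ + 1) ^ (-(3 / 2) : ℝ)) atTop (𝓝 1) := by
      have h2 : Tendsto (fun y : ℝ => (y ^ 2)⁻¹ + 1) atTop (𝓝 (0 + 1)) :=
        (tendsto_inv_atTop_zero.comp (tendsto_pow_atTop two_ne_zero)).add_const 1
      simpa using h2.rpow_const (p := (-(3 / 2) : ℝ)) (Or.inl (by norm_num))
    refine h1.congr' ?_
    filter_upwards [eventually_gt_atTop 0] with y hy
    have h3 : 1 + y ^ 2 = y ^ 2 * ((y ^ 2)⁻¹ + 1) := by field_simp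
    have h4 : (y ^ 2) ^ (-(3 / 2) : ℝ) = (y ^ 3)⁻¹ := by
      rw [← Real.rpow_natCast_mul hy.le, ← Real.rpow_natCast, ← Real.rpow_neg hy.le]
      norm_num
    rw [h3, Real.mul_rpow (by positivity) (by positivity), h4]
    field_simp
  have hderiv (y : ℝ) : HasDerivAt (fun y : ℝ => y ^ 3 * (1 + y ^ 2) ^ (-(3 / 2) : ℝ))
      (y ^ 2 * (3 * (1 + y ^ 2) ^ (-(5 / 2) : ℝ))) y := by
    have h1 : HasDerivAt (fun y : ℝ => 1 + y ^ 2) (2 * y) y := by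
      simpa using (hasDerivAt_pow 2 y).const_add 1
    have h2 := (hasDerivAt_pow 3 y).mul
      (h1.rpow_const (p := (-(3 / 2) : ℝ)) (Or.inl (by positivity)))
    refine h2.congr_deriv ?_
    have h3 : (-(3 / 2) - 1 : ℝ) = -(5 / 2) := by norm_num
    have h4 : (1 + y ^ 2) ^ (-(3 / 2) : ℝ) = (1 + y ^ 2) * (1 + y ^ 2) ^ (-(5 / 2) : ℝ) := by
      rw [← Real.rpow_one_add' (by positivity) (by norm_num)]
      norm_num
    rw [h3, h4]
    push_cast
    ring
  rw [integral_Ioi_of_hasDerivAt_of_nonneg' (fun y _ => hderiv y) (fun y _ => by positivity) hlim]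
  simp

/-- The mollifier on `ℝ³` that arises from the divergence of the regularized kernel. -/
def coulombMollifier (x : E3) : ℝ :=
  (4 * π)⁻¹ * (3 * (1 + ‖x‖ ^ 2) ^ (-(5 / 2) : ℝ))

lemma integral_coulombMollifier : ∫ x, coulombMollifier x = 1 := by
  unfold coulombMollifier
  rw [integral_const_mul,
    integral_fun_norm_addHaar volume fun y : ℝ => 3 * (1 + y ^ 2) ^ (-(5 / 2) : ℝ)]
  simp only [finrank_euclideanSpace, Fintype.card_fin, Measure.real,
    EuclideanSpace.volume_ball_fin_three, smul_eq_mul, nsmul_eq_mul, Nat.add_one_sub_one]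
  rw [integral_Ioi_sq_mul_one_add_sq_rpow]
  have := Real.pi_pos
  rw [ENNReal.toReal_mul, ENNReal.toReal_ofReal (by positivity)]
  simp
  field_simp

lemma tendsto_norm_pow_mul_coulombMollifier :
    Tendsto (fun x : E3 => ‖x‖ ^ Module.finrank ℝ E3 * coulombMollifier x)
      (Bornology.cobounded E3) (𝓝 0) := by
  have h : Tendsto (fun x : E3 => (4 * π)⁻¹ * 3 * ‖x‖ ^ (-2 : ℝ)) (Bornology.cobounded E3)
      (𝓝 ((4 * π)⁻¹ * 3 * 0)) :=
    ((tendsto_rpow_neg_atTop two_pos).comp tendsto_norm_cobounded_atTop).const_mul _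
  rw [mul_zero] at h
  have hpi := Real.pi_pos
  refine squeeze_zero' (Eventually.of_forall fun x => ?_) ?_ h
  · unfold coulombMollifier
    positivity
  filter_upwards [Bornology.eventually_ne_cobounded (0 : E3)] with x hx
  have hx' : 0 < ‖x‖ := norm_pos_iff.mpr hx
  have h1 : (1 + ‖x‖ ^ 2) ^ (-(5 / 2) : ℝ) ≤ (‖x‖ ^ 2) ^ (-(5 / 2) : ℝ) :=
    Real.rpow_le_rpow_of_nonpos (by positivity) (by linarith) (by norm_num)
  have h2 : ‖x‖ ^ (-2 : ℝ) = ‖x‖ ^ 3 * (‖x‖ ^ 2) ^ (-(5 / 2) : ℝ) := by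
    rw [← Real.rpow_natCast_mul hx'.le, ← Real.rpow_natCast, ← Real.rpow_add hx']
    norm_num
  rw [h2, coulombMollifier, finrank_euclideanSpace, Fintype.card_fin]
  calc _ = (4 * π)⁻¹ * 3 * (‖x‖ ^ 3 * (1 + ‖x‖ ^ 2) ^ (-(5 / 2) : ℝ)) := by ring
    _ ≤ _ := by gcongr

lemma sum_pd_regKernel_eq_coulombMollifier {c : ℝ} (hc : 0 < c) (x : E3) :
    ∑ i, pd i (regKernel (c ^ 2)⁻¹ i) x = 4 * π * (c ^ 3 * coulombMollifier (c • x)) := by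
  have hpi := Real.pi_pos
  have h1 : (c ^ 2)⁻¹ + ‖x‖ ^ 2 = (c ^ 2)⁻¹ * (1 + ‖c • x‖ ^ 2) := by
    rw [norm_smul, Real.norm_of_nonneg hc.le]
    field_simp
  have h2 : ((c ^ 2)⁻¹) ^ (-(5 / 2) : ℝ) = c ^ 5 := by
    rw [Real.inv_rpow (by positivity), ← Real.rpow_neg (by positivity),
      ← Real.rpow_natCast_mul hc.le, ← Real.rpow_natCast]
    norm_num
  rw [sum_pd_regKernel (by positivity), h1, Real.mul_rpow (by positivity) (by positivity), h2,
    coulombMollifier]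
  field_simp

lemma sum_integral_regKernel_zero_mul_pd {v : E3 → ℝ} (hv : ContDiff ℝ 1 v)
    (hc : HasCompactSupport v) :
    ∑ i, ∫ x, regKernel 0 i x * pd i v x = -(4 * π * v 0) := by
  have hpi := Real.pi_pos
  have hs : Tendsto (fun c : ℝ => (c ^ 2)⁻¹) atTop (𝓝[>] 0) :=
    tendsto_inv_atTop_nhdsGT_zero.comp (tendsto_pow_atTop two_ne_zero)
  have h1 := tendsto_finsetSum Finset.univ fun i _ =>
    (tendsto_integral_regKernel_mul i (hv.continuous_pd i) (hc.pd i)).comp hs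
  have h2 := ((tendsto_integral_comp_smul_smul_of_integrable (μ := volume)
    (fun x => by unfold coulombMollifier; positivity) integral_coulombMollifier
    tendsto_norm_pow_mul_coulombMollifier (hv.continuous.integrable_of_hasCompactSupport hc)
    hv.continuous.continuousAt).const_mul (4 * π)).neg
  refine tendsto_nhds_unique_of_eventuallyEq h1 h2 ?_
  filter_upwards [eventually_gt_atTop 0] with c hc0
  have hc2 : 0 < (c ^ 2)⁻¹ := by positivity
  simp only [Function.comp_apply, integral_regKernel_mul_pd hc2 _ _ hv hc, Finset.sum_neg_distrib]
  rw [← integral_finsetSum, ← integral_const_mul]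
  · congr 2 with x
    rw [← Finset.sum_mul, sum_pd_regKernel_eq_coulombMollifier hc0]
    simp [mul_assoc]
  · exact fun i _ => (((contDiff_regKernel hc2 i).continuous_pd i).mul
      hv.continuous).integrable_of_hasCompactSupport hc.mul_left

/-- The convolution of a scalar field with the `i`-th component of the kernel `x / ‖x‖³`. -/
def coulombField (i : Fin 3) (u : E3 → ℝ) (r : E3) : ℝ :=
  ∫ x, regKernel 0 i (r - x) * u x

lemma coulombField_eq_integral (i : Fin 3) (u : E3 → ℝ) (r : E3) :
    coulombField i u r = ∫ x, regKernel 0 i x * u (r - x) := by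
  rw [coulombField, ← integral_sub_left_eq_self _ volume r]
  simp

lemma contDiff_comp_sub_left {n : WithTop ℕ∞} {u : E3 → ℝ} (hu : ContDiff ℝ n u) (r : E3) :
    ContDiff ℝ n fun x => u (r - x) :=
  hu.comp (contDiff_const.sub contDiff_id)

lemma hasCompactSupport_comp_sub_left {u : E3 → ℝ} (hc : HasCompactSupport u) (r : E3) :
    HasCompactSupport fun x => u (r - x) :=
  hc.comp_homeomorph (Homeomorph.subLeft r)

lemma integrable_coulombField {u : E3 → ℝ} (hu : Continuous u) (hc : HasCompactSupport u)
    (i : Fin 3) (r : E3) : Integrable fun x => regKernel 0 i (r - x) * u x := by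
  have h := integrable_regKernel_mul le_rfl i
    (hu.comp (continuous_const.sub continuous_id) : Continuous fun x => u (r - x))
    (hasCompactSupport_comp_sub_left hc r)
  simpa using h.comp_sub_left r

lemma pd_comp_sub_left {u : E3 → ℝ} (hu : Differentiable ℝ u) (r : E3) (j : Fin 3) (x : E3) :
    pd j (fun x => u (r - x)) x = -pd j u (r - x) := by
  have h : HasFDerivAt (fun x => u (r - x)) _ x :=
    (hu (r - x)).hasFDerivAt.comp x ((hasFDerivAt_id x).const_sub r)
  simp [pd, h.fderiv]

lemma coulombField_pd_comm {u : E3 → ℝ} (hu : ContDiff ℝ 1 u) (hc : HasCompactSupport u)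
    (i j : Fin 3) (r : E3) : coulombField i (pd j u) r = coulombField j (pd i u) r := by
  have h := integral_regKernel_zero_mul_pd_comm i j (contDiff_comp_sub_left hu r)
    (hasCompactSupport_comp_sub_left hc r)
  simpa [pd_comp_sub_left (hu.differentiable one_ne_zero), integral_neg,
    coulombField_eq_integral] using h

lemma sum_coulombField_pd {u : E3 → ℝ} (hu : ContDiff ℝ 1 u) (hc : HasCompactSupport u) (r : E3) :
    ∑ i, coulombField i (pd i u) r = 4 * π * u r := by
  have h := sum_integral_regKernel_zero_mul_pd (contDiff_comp_sub_left hu r)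
    (hasCompactSupport_comp_sub_left hc r)
  simpa [pd_comp_sub_left (hu.differentiable one_ne_zero), integral_neg,
    coulombField_eq_integral] using h

lemma differentiableAt_coulombField_and_pd {u : E3 → ℝ} (hu : ContDiff ℝ 1 u)
    (hc : HasCompactSupport u) (i : Fin 3) (r : E3) : DifferentiableAt ℝ (coulombField i u) r ∧
      ∀ j, pd j (coulombField i u) r = coulombField i (pd j u) r := by
  have h := hc.hasFDerivAt_convolution_right (ContinuousLinearMap.mul ℝ ℝ) (μ := volume)
    (locallyIntegrable_regKernel_zero i) hu r
  have heq : coulombField i u =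
      convolution (regKernel 0 i) u (ContinuousLinearMap.mul ℝ ℝ) volume := by
    ext r
    simp [coulombField_eq_integral, convolution_def]
  rw [← heq] at h
  refine ⟨h.differentiableAt, fun j => ?_⟩
  rw [pd, h.fderiv, convolution_precompR_apply _ (locallyIntegrable_regKernel_zero i)
    (hc.fderiv ℝ) (hu.continuous_fderiv one_ne_zero)]
  simp [coulombField_eq_integral, convolution_def, pd]

lemma coulombField_add {u v : E3 → ℝ} (hu : Continuous u) (hcu : HasCompactSupport u)
    (hv : Continuous v) (hcv : HasCompactSupport v) (i : Fin 3) (r : E3) :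
    coulombField i (fun x => u x + v x) r = coulombField i u r + coulombField i v r := by
  simp only [coulombField, mul_add]
  exact integral_add (integrable_coulombField hu hcu i r) (integrable_coulombField hv hcv i r)

lemma coulombField_sub {u v : E3 → ℝ} (hu : Continuous u) (hcu : HasCompactSupport u)
    (hv : Continuous v) (hcv : HasCompactSupport v) (i : Fin 3) (r : E3) :
    coulombField i (fun x => u x - v x) r = coulombField i u r - coulombField i v r := by
  simp only [coulombField, mul_sub]
  exact integral_sub (integrable_coulombField hu hcu i r) (integrable_coulombField hv hcv i r)

lemma cross3_apply (a b : E3) (i : Fin 3) :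
    cross3 a b i = a (i + 1) * b (i + 2) - a (i + 2) * b (i + 1) := by
  fin_cases i <;> rfl

lemma curl3_apply (F : E3 → E3) (x : E3) (i : Fin 3) :
    curl3 F x i = pd (i + 1) (fun y => F y (i + 2)) x - pd (i + 2) (fun y => F y (i + 1)) x := by
  fin_cases i <;> rfl

section VectorField

variable {F : E3 → E3}

lemma contDiff_component (hF : ContDiff ℝ (⊤ : ℕ∞) F) (i : Fin 3) :
    ContDiff ℝ (⊤ : ℕ∞) fun x => F x i := by
  fun_prop

lemma hasCompactSupport_component (hc : HasCompactSupport F) (i : Fin 3) :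
    HasCompactSupport fun x => F x i :=
  hc.comp_left (g := fun v : E3 => v i) rfl

lemma contDiff_div3 (hF : ContDiff ℝ (⊤ : ℕ∞) F) : ContDiff ℝ (⊤ : ℕ∞) (div3 F) :=
  (((contDiff_component hF 0).pd 0).add ((contDiff_component hF 1).pd 1)).add
    ((contDiff_component hF 2).pd 2)

lemma hasCompactSupport_div3 (hc : HasCompactSupport F) : HasCompactSupport (div3 F) :=
  (((hasCompactSupport_component hc 0).pd 0).add ((hasCompactSupport_component hc 1).pd 1)).add
    ((hasCompactSupport_component hc 2).pd 2)

lemma contDiff_curl3_apply (hF : ContDiff ℝ (⊤ : ℕ∞) F) (i : Fin 3) :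
    ContDiff ℝ (⊤ : ℕ∞) fun x => curl3 F x i := by
  simp only [curl3_apply]
  exact ((contDiff_component hF _).pd _).sub ((contDiff_component hF _).pd _)

lemma hasCompactSupport_curl3_apply (hc : HasCompactSupport F) (i : Fin 3) :
    HasCompactSupport fun x => curl3 F x i := by
  simp only [curl3_apply]
  exact ((hasCompactSupport_component hc _).pd _).sub ((hasCompactSupport_component hc _).pd _)

lemma helmholtzConservative_apply (hF : ContDiff ℝ (⊤ : ℕ∞) F) (hc : HasCompactSupport F)
    (r : E3) (i : Fin 3) :
    helmholtzConservative F r i = (4 * π)⁻¹ * coulombField i (div3 F) r := by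
  have h (i : Fin 3) (x : E3) : ((‖r - x‖ ^ 3)⁻¹ • (div3 F x • (r - x))) i =
      regKernel 0 i (r - x) * div3 F x := by
    simp only [PiLp.smul_apply, smul_eq_mul, regKernel_zero]
    ring
  rw [helmholtzConservative, PiLp.smul_apply, eval_integral_piLp]
  · simp only [h, coulombField, smul_eq_mul, one_div]
  · intro j
    simp only [h]
    exact integrable_coulombField (contDiff_div3 hF).continuous (hasCompactSupport_div3 hc) j r

lemma helmholtzSolenoidal_apply (hF : ContDiff ℝ (⊤ : ℕ∞) F) (hc : HasCompactSupport F)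
    (r : E3) (i : Fin 3) :
    helmholtzSolenoidal F r i = (4 * π)⁻¹ * (coulombField (i + 2) (fun x => curl3 F x (i + 1)) r -
      coulombField (i + 1) (fun x => curl3 F x (i + 2)) r) := by
  have h (i : Fin 3) (x : E3) : ((‖r - x‖ ^ 3)⁻¹ • cross3 (curl3 F x) (r - x)) i =
      regKernel 0 (i + 2) (r - x) * curl3 F x (i + 1) -
        regKernel 0 (i + 1) (r - x) * curl3 F x (i + 2) := by
    simp only [PiLp.smul_apply, smul_eq_mul, regKernel_zero, cross3_apply]
    ring
  have hint (i j : Fin 3) : Integrable fun x => regKernel 0 i (r - x) * curl3 F x j :=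
    integrable_coulombField (contDiff_curl3_apply hF j).continuous
      (hasCompactSupport_curl3_apply hc j) i r
  rw [helmholtzSolenoidal, PiLp.smul_apply, eval_integral_piLp]
  · simp only [h, coulombField, smul_eq_mul, one_div]
    rw [integral_sub (hint _ _) (hint _ _)]
  · intro j
    simp only [h]
    exact (hint _ _).sub (hint _ _)

lemma pd_helmholtzConservative (hF : ContDiff ℝ (⊤ : ℕ∞) F) (hc : HasCompactSupport F)
    (r : E3) (i j : Fin 3) :
    pd j (fun x => helmholtzConservative F x i) r =
      (4 * π)⁻¹ * coulombField i (pd j (div3 F)) r := by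
  obtain ⟨hd, hpd⟩ := differentiableAt_coulombField_and_pd ((contDiff_div3 hF).of_le (by simp))
    (hasCompactSupport_div3 hc) i r
  simp only [helmholtzConservative_apply hF hc, ← hpd]
  simp [pd, fderiv_const_mul hd]

lemma pd_helmholtzSolenoidal (hF : ContDiff ℝ (⊤ : ℕ∞) F) (hc : HasCompactSupport F)
    (r : E3) (i j : Fin 3) :
    pd j (fun x => helmholtzSolenoidal F x i) r =
      (4 * π)⁻¹ * (coulombField (i + 2) (pd j fun x => curl3 F x (i + 1)) r -
        coulombField (i + 1) (pd j fun x => curl3 F x (i + 2)) r) := by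
  have h (i k : Fin 3) := differentiableAt_coulombField_and_pd
    ((contDiff_curl3_apply hF k).of_le (by simp)) (hasCompactSupport_curl3_apply hc k) i r
  simp only [helmholtzSolenoidal_apply hF hc, ← (h _ _).2]
  rw [pd, fderiv_const_mul ((h _ _).1.fun_sub (h _ _).1), fderiv_fun_sub (h _ _).1 (h _ _).1]
  rfl

lemma eq_helmholtzConservative_add_helmholtzSolenoidal (hF : ContDiff ℝ (⊤ : ℕ∞) F)
    (hc : HasCompactSupport F) (r : E3) :
    F r = helmholtzConservative F r + helmholtzSolenoidal F r := by
  have hu (k j : Fin 3) := ((contDiff_component hF k).pd j).continuous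
  have hcu (k j : Fin 3) := (hasCompactSupport_component hc k).pd j
  have hcomm (i j k : Fin 3) := coulombField_pd_comm ((contDiff_component hF k).of_le (by simp))
    (hasCompactSupport_component hc k) i j r
  have hdiv (i : Fin 3) : coulombField i (div3 F) r =
      coulombField i (pd 0 fun x => F x 0) r + coulombField i (pd 1 fun x => F x 1) r +
        coulombField i (pd 2 fun x => F x 2) r := by
    rw [← coulombField_add (hu 0 0) (hcu 0 0) (hu 1 1) (hcu 1 1),
      ← coulombField_add ((hu 0 0).fun_add (hu 1 1)) ((hcu 0 0).add (hcu 1 1)) (hu 2 2) (hcu 2 2)]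
    rfl
  have hcurl (i k : Fin 3) : coulombField i (fun x => curl3 F x k) r =
      coulombField i (pd (k + 1) fun x => F x (k + 2)) r -
        coulombField i (pd (k + 2) fun x => F x (k + 1)) r := by
    simp only [curl3_apply]
    exact coulombField_sub (hu _ _) (hcu _ _) (hu _ _) (hcu _ _) i r
  have hsum (k : Fin 3) : F r k = (4 * π)⁻¹ * ∑ i, coulombField i (pd i fun x => F x k) r := by
    rw [sum_coulombField_pd ((contDiff_component hF k).of_le (by simp))
      (hasCompactSupport_component hc k), inv_mul_cancel_left₀ (by positivity)]
  ext k
  rw [PiLp.add_apply, helmholtzConservative_apply hF hc, helmholtzSolenoidal_apply hF hc, hsum,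
    hdiv, hcurl, hcurl, Fin.sum_univ_three, ← mul_add]
  congr 1
  fin_cases k <;> simp [Fin.isValue, show (1 : Fin 3) + 2 = 0 from rfl,
    show (2 : Fin 3) + 1 = 0 from rfl, show (2 : Fin 3) + 2 = 1 from rfl,
    show (1 : Fin 3) + 1 = 2 from rfl]
  · linear_combination hcomm 2 0 2 + hcomm 1 0 1
  · linear_combination hcomm 0 1 0 + hcomm 2 1 2
  · linear_combination hcomm 1 2 1 + hcomm 0 2 0

lemma curl3_helmholtzConservative (hF : ContDiff ℝ (⊤ : ℕ∞) F) (hc : HasCompactSupport F)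
    (r : E3) : curl3 (helmholtzConservative F) r = 0 := by
  ext i
  rw [curl3_apply, pd_helmholtzConservative hF hc, pd_helmholtzConservative hF hc,
    coulombField_pd_comm ((contDiff_div3 hF).of_le (by simp)) (hasCompactSupport_div3 hc), sub_self]
  rfl

lemma div3_helmholtzSolenoidal (hF : ContDiff ℝ (⊤ : ℕ∞) F) (hc : HasCompactSupport F)
    (r : E3) : div3 (helmholtzSolenoidal F) r = 0 := by
  have hcomm (i j k : Fin 3) := coulombField_pd_comm
    ((contDiff_curl3_apply hF k).of_le (by simp)) (hasCompactSupport_curl3_apply hc k) i j r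
  simp only [div3, pd_helmholtzSolenoidal hF hc]
  simp only [Fin.isValue, zero_add, show (1 : Fin 3) + 2 = 0 from rfl,
    show (2 : Fin 3) + 1 = 0 from rfl, show (2 : Fin 3) + 2 = 1 from rfl,
    show (1 : Fin 3) + 1 = 2 from rfl]
  linear_combination (4 * π)⁻¹ * (hcomm 2 0 1 + hcomm 0 1 2 + hcomm 1 2 0)

end VectorField

/-- **Helmholtz decomposition theorem.** A smooth compactly supported vector field on ℝ³
decomposes as F = F_c + F_s, where F_c is irrotational and F_s is divergence-free. -/
theorem helmholtz_decomposition (F : E3 → E3)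
    (hF : ContDiff ℝ (⊤ : ℕ∞) F) (hsupp : HasCompactSupport F) :
    (∀ r : E3, F r = helmholtzConservative F r + helmholtzSolenoidal F r) ∧
    (∀ r : E3, curl3 (helmholtzConservative F) r = 0) ∧
    (∀ r : E3, div3 (helmholtzSolenoidal F) r = 0) := by
  exact ⟨eq_helmholtzConservative_add_helmholtzSolenoidal hF hsupp,
    curl3_helmholtzConservative hF hsupp, div3_helmholtzSolenoidal hF hsupp⟩
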